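/- arXiv:1103.3862 — 2 statements merged into one kernel-verified Lean document; each statement's English description precedes it below -/
import Mathlib

section
/- Let x̄ be a local minimizer of the infinite program: minimize f(x) subject to g_t(x) ≤ 0 (t ∈ T) and h(x) = 0. Suppose the PMFCQ and the NFMCQ hold at x̄, the family {g_t}_{t∈T} is uniformly Fréchet differentiable at x̄, and f is Fréchet differentiable at x̄. Then there exist nonnegative multipliers λ = (λ_t)_{t∈T} with λ_t ≠ 0 for at most finitely many t, λ_t = 0 for all t ∉ T(x̄), and y* ∈ Y* such that 0 = ∇f(x̄) + Σ_{t∈T(x̄)} λ_t ∇g_t(x̄) + ∇h(x̄)*y* (differential KKT condition). -/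
open Filter Topology Set Pointwise

section Defs

variable {X : Type*} [NormedAddCommGroup X] [NormedSpace ℝ X]

/-- The canonical identification of the dual of `X` with its weak* dual. -/
def toWD (p : X →L[ℝ] ℝ) : WeakDual ℝ X := p

/-- The weak* closure of a subset of the dual. -/
def wkClosure (S : Set (X →L[ℝ] ℝ)) : Set (X →L[ℝ] ℝ) :=
  {p | toWD p ∈ closure (toWD '' S)}

/-- A subset of the dual is weak* closed. -/
def IsWeakStarClosed (S : Set (X →L[ℝ] ℝ)) : Prop :=
  IsClosed (toWD '' S)

/-- A subset of `X* × ℝ` is weak* closed. -/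
def IsWeakStarClosedProd (S : Set ((X →L[ℝ] ℝ) × ℝ)) : Prop :=
  IsClosed ((fun p : (X →L[ℝ] ℝ) × ℝ => (toWD p.1, p.2)) '' S)

/-- The convex conic hull of `S ∪ {0}`: all finite nonnegative combinations of elements of `S`. -/
def coneHull {E : Type*} [AddCommMonoid E] [Module ℝ E] (S : Set E) : Set E :=
  {x | ∃ (n : ℕ) (c : Fin n → ℝ) (v : Fin n → E),
    (∀ i, 0 ≤ c i) ∧ (∀ i, v i ∈ S) ∧ x = ∑ i, c i • v i}

/-- The set of ε-normals to `Ω` at `x`. -/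
def epsNormal (Ω : Set X) (x : X) (ε : ℝ) : Set (X →L[ℝ] ℝ) :=
  {p | ∀ γ > (0:ℝ), ∃ δ > (0:ℝ), ∀ u ∈ Ω, ‖u - x‖ < δ → p (u - x) ≤ (ε + γ) * ‖u - x‖}

/-- The Fréchet (regular) normal cone to `Ω` at `x`. -/
def frechetNormal (Ω : Set X) (x : X) : Set (X →L[ℝ] ℝ) := epsNormal Ω x 0

/-- The limiting (Mordukhovich) normal cone to `Ω` at `xb`. -/
def limitingNormal (Ω : Set X) (xb : X) : Set (X →L[ℝ] ℝ) :=
  {p | ∃ (ε : ℕ → ℝ) (xs : ℕ → X) (ps : ℕ → X →L[ℝ] ℝ),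
    (∀ n, 0 ≤ ε n) ∧ Tendsto ε atTop (𝓝 0) ∧
    (∀ n, xs n ∈ Ω) ∧ Tendsto xs atTop (𝓝 xb) ∧
    (∀ n, ps n ∈ epsNormal Ω (xs n) (ε n)) ∧
    (∀ v : X, Tendsto (fun n => ps n v) atTop (𝓝 (p v)))}

/-- The normal cone of convex analysis to `Ω` at `xb`. -/
def convexNormal (Ω : Set X) (xb : X) : Set (X →L[ℝ] ℝ) :=
  {p | ∀ x ∈ Ω, p (x - xb) ≤ 0}

/-- The subdifferential of convex analysis of `f` at `xb`. -/
def convexSubdiff (f : X → ℝ) (xb : X) : Set (X →L[ℝ] ℝ) :=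
  {p | ∀ x, f xb + p (x - xb) ≤ f x}

variable {Y : Type*} [NormedAddCommGroup Y] [NormedSpace ℝ Y]

/-- The image `A*(Y*)` of the adjoint operator `A* : Y* → X*`. -/
def adjRange (A : X →L[ℝ] Y) : Set (X →L[ℝ] ℝ) :=
  Set.range fun q : Y →L[ℝ] ℝ => q.comp A

variable {T : Type*}

/-- Uniform Fréchet differentiability of the family `g = (g t)` at `xb`:
`s(η) := sup_t sup_{x ∈ B_η(xb), x ≠ xb} |g t x - g t xb - ⟨dg t, x - xb⟩|/‖x - xb‖ → 0` as `η ↓ 0`. -/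
def UnifFrechetDiffAt (g : T → X → ℝ) (dg : T → X →L[ℝ] ℝ) (xb : X) : Prop :=
  ∀ ε > (0:ℝ), ∃ η > (0:ℝ), ∀ t : T, ∀ x : X, ‖x - xb‖ ≤ η →
    |g t x - g t xb - dg t (x - xb)| ≤ ε * ‖x - xb‖

/-- Uniform strict differentiability of the family `g = (g t)` at `xb`:
`r(η) := sup_t sup_{x,x' ∈ B_η(xb), x ≠ x'} |g t x - g t x' - ⟨dg t, x - x'⟩|/‖x - x'‖ → 0`
as `η ↓ 0`. -/
def UnifStrictDiffAt (g : T → X → ℝ) (dg : T → X →L[ℝ] ℝ) (xb : X) : Prop :=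
  ∀ ε > (0:ℝ), ∃ η > (0:ℝ), ∀ t : T, ∀ x x' : X, ‖x - xb‖ ≤ η → ‖x' - xb‖ ≤ η →
    |g t x - g t x' - dg t (x - x')| ≤ ε * ‖x - x'‖

/-- The inequality part of the PMFCQ at `xb` with the direction `xt`:
`inf_{ε>0} sup_{t ∈ T_ε(xb)} ⟨dg t, xt⟩ < 0`, where `T_ε(xb) = {t | g t xb ≥ -ε}`. -/
def PMFCQat (g : T → X → ℝ) (dg : T → X →L[ℝ] ℝ) (xb xt : X) : Prop :=
  ∃ ε > (0:ℝ), ∃ δ > (0:ℝ), ∀ t : T, -ε ≤ g t xb → dg t xt ≤ -δ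

end Defs

/-- Lyusternik type correction: an almost solution along a tangent direction can be corrected. -/
theorem aux_lyu {X Y : Type*} [NormedAddCommGroup X] [NormedSpace ℝ X] [CompleteSpace X]
    [NormedAddCommGroup Y] [NormedSpace ℝ Y] [CompleteSpace Y]
    (h : X → Y) (dh : X →L[ℝ] Y) (xb : X) (hhd : HasStrictFDerivAt h dh xb)
    (h0 : h xb = 0) (hsurj : Function.Surjective dh) (e : X) (he : dh e = 0)
    (κ : ℝ) (hκ : 0 < κ) :
    ∀ᶠ s : ℝ in 𝓝[>] 0, ∃ x, h x = 0 ∧ ‖x - (xb + s • e)‖ ≤ κ * s := by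
  have hr : (dh : X →ₗ[ℝ] Y).range = ⊤ := LinearMap.range_eq_top.2 hsurj
  let R := dh.nonlinearRightInverseOfSurjective hr
  have hR : 0 < R.nnnorm := ContinuousLinearMap.nonlinearRightInverseOfSurjective_nnnorm_pos dh hr
  have hR' : (0:ℝ) < R.nnnorm := hR
  obtain ⟨U, hU, hUa⟩ := hhd.approximates_deriv_on_nhds (c := R.nnnorm⁻¹ / 2)
    (Or.inr (by positivity))
  obtain ⟨r, hr0, hrU⟩ := Metric.mem_nhds_iff.1 hU
  set c : ℝ := (R.nnnorm : ℝ)⁻¹ / 2 with hc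
  have hc0 : 0 < c := by positivity
  -- the norm of `h` along the ray
  have hb := hhd.hasFDerivAt.isLittleO.def (c := c * κ / (‖e‖ + 1)) (by positivity)
  have ht : Tendsto (fun s : ℝ => xb + s • e) (𝓝[>] 0) (𝓝 xb) := by
    have : Continuous (fun s : ℝ => xb + s • e) := by fun_prop
    have := this.tendsto 0
    simp only [zero_smul, add_zero] at this
    exact this.mono_left nhdsWithin_le_nhds
  have hsm : ∀ᶠ s : ℝ in 𝓝[>] 0, s * (‖e‖ + κ) < r := by
    have : Continuous (fun s : ℝ => s * (‖e‖ + κ)) := by fun_prop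
    have := this.tendsto 0
    simp only [zero_mul] at this
    exact (this.mono_left nhdsWithin_le_nhds).eventually (gt_mem_nhds hr0)
  filter_upwards [ht.eventually hb, hsm, self_mem_nhdsWithin] with s hs1 hs2 hs3
  have hs : 0 < s := hs3
  have hsub : Metric.closedBall (xb + s • e) (κ * s) ⊆ U := by
    intro x hx
    apply hrU
    rw [Metric.mem_ball, dist_eq_norm]
    rw [Metric.mem_closedBall, dist_eq_norm] at hx
    have : x - xb = (x - (xb + s • e)) + s • e := by abel
    rw [this]
    have h2 : ‖s • e‖ = s * ‖e‖ := by rw [norm_smul, Real.norm_of_nonneg hs.le]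
    calc _ ≤ _ := norm_add_le _ _
      _ ≤ κ * s + s * ‖e‖ := by rw [h2]; linarith
      _ < r := by linarith
  have hsj := hUa.surjOn_closedBall_of_nonlinearRightInverse R (ε := κ * s) (b := xb + s • e)
    (by positivity) hsub
  have hmem : (0:Y) ∈ Metric.closedBall (h (xb + s • e))
      (((R.nnnorm : ℝ)⁻¹ - ((R.nnnorm⁻¹ / 2 : NNReal) : ℝ)) * (κ * s)) := by
    rw [Metric.mem_closedBall, dist_eq_norm, zero_sub, norm_neg]
    simp only [h0, sub_zero, add_sub_cancel_left, map_smul, he, smul_zero] at hs1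
    rw [norm_smul, Real.norm_of_nonneg hs.le] at hs1
    refine hs1.trans ?_
    have e1 : ((R.nnnorm : ℝ)⁻¹ - ((R.nnnorm⁻¹ / 2 : NNReal) : ℝ)) = c := by
      push_cast; rw [hc]; ring
    rw [e1, div_mul_eq_mul_div, div_le_iff₀ (by positivity)]
    have : 0 ≤ c * κ * s := by positivity
    nlinarith
  obtain ⟨x, hx1, hx2⟩ := hsj hmem
  exact ⟨x, hx2, by simpa [dist_eq_norm] using hx1⟩

/-- Points near a strictly decreasing direction satisfy all inequality constraints. -/
theorem aux_feas {X T : Type*} [NormedAddCommGroup X] [NormedSpace ℝ X]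
    (g : T → X → ℝ) (dg : T → X →L[ℝ] ℝ) (xb : X)
    (M : ℝ) (hM : ∀ t : T, ‖dg t‖ ≤ M) (hg0 : ∀ t, g t xb ≤ 0)
    (hunif : UnifFrechetDiffAt g dg xb) (e : X) (a ε τ : ℝ) (hε : 0 < ε) (hτ : 0 < τ)
    (he : ∀ t, -ε ≤ g t xb → dg t e ≤ -a * g t xb - τ) :
    ∃ κ > (0:ℝ), ∀ᶠ s : ℝ in 𝓝[>] 0, ∀ x, ‖x - (xb + s • e)‖ ≤ κ * s → ∀ t, g t x ≤ 0 := by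
  set N : ℝ := max M 0 with hN
  have hN0 : 0 ≤ N := le_max_right _ _
  have hMN : ∀ t, ‖dg t‖ ≤ N := fun t => (hM t).trans (le_max_left _ _)
  obtain ⟨κ, hκ0, hκ1, hκN⟩ : ∃ κ : ℝ, 0 < κ ∧ κ ≤ 1 ∧ N * κ ≤ τ / 2 := by
    refine ⟨min 1 (τ / (2 * (N + 1))), by positivity, min_le_left _ _, ?_⟩
    have : min 1 (τ / (2 * (N + 1))) ≤ τ / (2 * (N + 1)) := min_le_right _ _
    rw [le_div_iff₀ (by positivity)] at this
    have h0 : 0 < min 1 (τ / (2 * (N + 1))) := by positivity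
    nlinarith
  set μ : ℝ := τ / (2 * (‖e‖ + 1)) with hμ
  have hμ0 : 0 < μ := by positivity
  have hμe : μ * (‖e‖ + 1) = τ / 2 := by rw [hμ]; field_simp
  obtain ⟨η, hη, hu⟩ := hunif μ hμ0
  refine ⟨κ, hκ0, ?_⟩
  have lin : ∀ (A B : ℝ), 0 < B → ∀ᶠ s : ℝ in 𝓝[>] 0, s * A < B := by
    intro A B hB
    have : Continuous (fun s : ℝ => s * A) := by fun_prop
    have := this.tendsto 0
    simp only [zero_mul] at this
    exact (this.mono_left nhdsWithin_le_nhds).eventually (gt_mem_nhds hB)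
  filter_upwards [lin (‖e‖ + 1) η hη, lin a 1 one_pos, lin (N * ‖e‖ + τ) ε hε,
    self_mem_nhdsWithin] with s hs1 hs2 hs3 hs4 x hx t
  have hs : 0 < s := hs4
  have hxe : x - xb = (x - (xb + s • e)) + s • e := by abel
  have h2 : ‖s • e‖ = s * ‖e‖ := by rw [norm_smul, Real.norm_of_nonneg hs.le]
  have hnx : ‖x - xb‖ ≤ s * (‖e‖ + 1) := by
    rw [hxe]
    refine (norm_add_le _ _).trans ?_
    rw [h2]
    nlinarith
  have hut := hu t x (by linarith)
  have hut2 := (abs_le.1 hut).2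
  have hd : dg t (x - xb) ≤ s * dg t e + s * (τ / 2) := by
    rw [hxe, map_add, map_smul, smul_eq_mul]
    have : dg t (x - (xb + s • e)) ≤ N * (κ * s) :=
      (le_abs_self _).trans (((dg t).le_opNorm _).trans
        (mul_le_mul (hMN t) hx (norm_nonneg _) hN0))
    nlinarith
  have hmx : μ * ‖x - xb‖ ≤ s * (τ / 2) := by
    calc _ ≤ μ * (s * (‖e‖ + 1)) := by gcongr
      _ = s * (μ * (‖e‖ + 1)) := by ring
      _ = _ := by rw [hμe]
  have hgx : g t x ≤ g t xb + s * dg t e + s * τ := by linarith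
  by_cases hcase : -ε ≤ g t xb
  · have h3 := mul_le_mul_of_nonneg_left (he t hcase) hs.le
    have h4 := hg0 t
    nlinarith
  · push Not at hcase
    have h5 : dg t e ≤ N * ‖e‖ :=
      (le_abs_self _).trans (((dg t).le_opNorm _).trans
        (mul_le_mul_of_nonneg_right (hMN t) (norm_nonneg _)))
    nlinarith

/-- Primal first order condition. -/
theorem aux_primal {X Y T : Type*} [NormedAddCommGroup X] [NormedSpace ℝ X] [CompleteSpace X]
    [NormedAddCommGroup Y] [NormedSpace ℝ Y] [CompleteSpace Y]
    (f : X → ℝ) (df : X →L[ℝ] ℝ) (g : T → X → ℝ) (dg : T → X →L[ℝ] ℝ)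
    (h : X → Y) (dh : X →L[ℝ] Y) (xb : X)
    (hhd : HasStrictFDerivAt h dh xb)
    (M : ℝ) (hM : ∀ t : T, ‖dg t‖ ≤ M)
    (h0 : h xb = 0) (hg0 : ∀ t : T, g t xb ≤ 0)
    (hmin : ∃ ρ > (0:ℝ), ∀ x ∈ {x : X | h x = 0 ∧ ∀ t : T, g t x ≤ 0},
      ‖x - xb‖ < ρ → f xb ≤ f x)
    (hsurj : Function.Surjective dh)
    (xt : X) (hxt : dh xt = 0) (hpm : PMFCQat g dg xb xt)
    (hunif : UnifFrechetDiffAt g dg xb)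
    (hfd : HasFDerivAt f df xb) (d : X) (hd : dh d = 0) (a : ℝ)
    (hda : ∀ t, dg t d ≤ -a * g t xb) : 0 ≤ df d := by
  obtain ⟨ρ, hρ, hmin⟩ := hmin
  obtain ⟨ε, hε, δ, hδ, hp⟩ := hpm
  have key : ∀ θ > (0:ℝ), 0 ≤ df (d + θ • xt) := by
    intro θ hθ
    set e := d + θ • xt with he
    have hde : dh e = 0 := by simp [he, hd, hxt]
    obtain ⟨κ0, hκ0, hfe⟩ := aux_feas g dg xb M hM hg0 hunif e a ε (θ * δ) hε (by positivity) (by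
      intro t ht
      have := hda t
      have := hp t ht
      simp only [he, map_add, map_smul, smul_eq_mul]
      nlinarith)
    have key2 : ∀ κ > (0:ℝ), κ ≤ min κ0 1 → 0 ≤ df e + κ * (‖df‖ + ‖e‖ + 1) := by
      intro κ hκ hκm
      have hκa : κ ≤ κ0 := hκm.trans (min_le_left _ _)
      have hκb : κ ≤ 1 := hκm.trans (min_le_right _ _)
      obtain ⟨r, hr, hrf⟩ := Metric.eventually_nhds_iff.1 (hfd.isLittleO.def (c := κ) hκ)
      have hsm : ∀ᶠ s : ℝ in 𝓝[>] 0, s * (‖e‖ + 1) < min r ρ := by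
        have : Continuous (fun s : ℝ => s * (‖e‖ + 1)) := by fun_prop
        have := this.tendsto 0
        simp only [zero_mul] at this
        exact (this.mono_left nhdsWithin_le_nhds).eventually (gt_mem_nhds (by positivity))
      obtain ⟨s, hs1, hs2, hs3, hs4⟩ := (hfe.and ((aux_lyu h dh xb hhd h0 hsurj e hde κ hκ).and
        (hsm.and self_mem_nhdsWithin))).exists
      have hs : 0 < s := hs4
      obtain ⟨x, hx1, hx2⟩ := hs2
      have hxg := hs1 x (hx2.trans (by gcongr))
      have hxe : x - xb = (x - (xb + s • e)) + s • e := by abel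
      have h2 : ‖s • e‖ = s * ‖e‖ := by rw [norm_smul, Real.norm_of_nonneg hs.le]
      have hnx : ‖x - xb‖ ≤ s * (‖e‖ + 1) := by
        rw [hxe]
        refine (norm_add_le _ _).trans ?_
        rw [h2]
        nlinarith
      have hff := hmin x ⟨hx1, hxg⟩ (by linarith [min_le_right r ρ])
      have hfo := hrf (y := x) (by rw [dist_eq_norm]; linarith [min_le_left r ρ])
      rw [Real.norm_eq_abs] at hfo
      have hfo := (abs_le.1 hfo).2
      have h3 : df (x - xb) ≤ s * df e + s * (κ * ‖df‖) := by
        rw [hxe, map_add, map_smul, smul_eq_mul]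
        have : df (x - (xb + s • e)) ≤ ‖df‖ * (κ * s) :=
          (le_abs_self _).trans ((df.le_opNorm _).trans
            (mul_le_mul_of_nonneg_left hx2 (norm_nonneg _)))
        nlinarith
      have h4 : κ * ‖x - xb‖ ≤ κ * (s * (‖e‖ + 1)) := by gcongr
      have h5 : 0 ≤ s * (df e + κ * (‖df‖ + ‖e‖ + 1)) := by nlinarith
      exact nonneg_of_mul_nonneg_right h5 hs
    have hlim : Tendsto (fun κ : ℝ => df e + κ * (‖df‖ + ‖e‖ + 1)) (𝓝[>] 0) (𝓝 (df e)) := by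
      have : Continuous (fun κ : ℝ => df e + κ * (‖df‖ + ‖e‖ + 1)) := by fun_prop
      have := this.tendsto 0
      simp only [zero_mul, add_zero] at this
      exact this.mono_left nhdsWithin_le_nhds
    refine ge_of_tendsto hlim ?_
    have h1 : (0:ℝ) < min κ0 1 := by positivity
    filter_upwards [Ioc_mem_nhdsGT h1] with κ hκ
    exact key2 κ hκ.1 hκ.2
  have hlim : Tendsto (fun θ : ℝ => df (d + θ • xt)) (𝓝[>] 0) (𝓝 (df d)) := by
    have : Continuous (fun θ : ℝ => df (d + θ • xt)) := by fun_prop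
    have := this.tendsto 0
    simp only [zero_smul, add_zero] at this
    exact this.mono_left nhdsWithin_le_nhds
  refine ge_of_tendsto hlim ?_
  filter_upwards [self_mem_nhdsWithin] with θ hθ
  exact key θ hθ

/-- A functional vanishing on the kernel of a surjective operator factors through it. -/
theorem aux_factor {X Y : Type*} [NormedAddCommGroup X] [NormedSpace ℝ X] [CompleteSpace X]
    [NormedAddCommGroup Y] [NormedSpace ℝ Y] [CompleteSpace Y]
    (dh : X →L[ℝ] Y) (hsurj : Function.Surjective dh) (n : X →L[ℝ] ℝ)
    (hn : ∀ x, dh x = 0 → n x = 0) : ∃ q : Y →L[ℝ] ℝ, n = q.comp dh := by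
  have hr : (dh : X →ₗ[ℝ] Y).range = ⊤ := LinearMap.range_eq_top.2 hsurj
  let R := dh.nonlinearRightInverseOfSurjective hr
  have hR : ∀ y, dh (R y) = y := R.right_inv
  have hx : ∀ x y, dh x = dh y → n x = n y := by
    intro x y hxy
    have := hn (x - y) (by simp [hxy])
    rw [map_sub] at this
    linarith
  let q : Y →ₗ[ℝ] ℝ :=
    { toFun := fun y => n (R y)
      map_add' := fun y z => by
        rw [← map_add]; apply hx; simp [hR]
      map_smul' := fun c y => by
        simp only [RingHom.id_apply]
        rw [← map_smul]; apply hx; simp [hR] }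
  refine ⟨q.mkContinuous (‖n‖ * R.nnnorm) ?_, ?_⟩
  · intro y
    calc _ ≤ ‖n‖ * ‖R y‖ := n.le_opNorm _
      _ ≤ ‖n‖ * (R.nnnorm * ‖y‖) := by gcongr; exact R.bound y
      _ = _ := by ring
  · ext x
    exact hx _ _ (hR _).symm

/-- The conic hull as a linear-map friendly convex set. -/
theorem aux_cone_add {E : Type*} [AddCommMonoid E] [Module ℝ E] {S : Set E} {x y : E}
    (hx : x ∈ coneHull S) (hy : y ∈ coneHull S) : x + y ∈ coneHull S := by
  obtain ⟨n, c, v, hc, hv, rfl⟩ := hx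
  obtain ⟨m, c', v', hc', hv', rfl⟩ := hy
  refine ⟨n + m, Fin.append c c', Fin.append v v', ?_, ?_, ?_⟩
  · intro i
    refine Fin.addCases (fun i => ?_) (fun i => ?_) i
    · simpa using hc i
    · simpa using hc' i
  · intro i
    refine Fin.addCases (fun i => ?_) (fun i => ?_) i
    · simpa using hv i
    · simpa using hv' i
  · simp [Fin.sum_univ_add]

theorem aux_cone_smul {E : Type*} [AddCommMonoid E] [Module ℝ E] {S : Set E} {x : E}
    (hx : x ∈ coneHull S) {a : ℝ} (ha : 0 ≤ a) : a • x ∈ coneHull S := by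
  obtain ⟨n, c, v, hc, hv, rfl⟩ := hx
  exact ⟨n, fun i => a * c i, v, fun i => mul_nonneg ha (hc i), hv, by
    simp [Finset.smul_sum, mul_smul]⟩

theorem aux_cone_single {E : Type*} [AddCommMonoid E] [Module ℝ E] {S : Set E} {x : E}
    (hx : x ∈ S) : x ∈ coneHull S :=
  ⟨1, fun _ => 1, fun _ => x, fun _ => zero_le_one, fun _ => hx, by simp⟩

theorem aux_cone_zero {E : Type*} [AddCommMonoid E] [Module ℝ E] (S : Set E) :
    (0 : E) ∈ coneHull S :=
  ⟨0, Fin.elim0, Fin.elim0, fun i => i.elim0, fun i => i.elim0, by simp⟩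

theorem aux_cone_convex {E : Type*} [AddCommMonoid E] [Module ℝ E] (S : Set E) :
    Convex ℝ (coneHull S) := by
  intro x hx y hy a b ha hb _
  exact aux_cone_add (aux_cone_smul hx ha) (aux_cone_smul hy hb)

/-- A bound on the elements of the cone coming from the PMFCQ. -/
theorem aux_bound {X T : Type*} [NormedAddCommGroup X] [NormedSpace ℝ X]
    (g : T → X → ℝ) (dg : T → X →L[ℝ] ℝ) (xb xt : X)
    (M : ℝ) (hM : ∀ t : T, ‖dg t‖ ≤ M) (hg0 : ∀ t, g t xb ≤ 0) (hpm : PMFCQat g dg xb xt) :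
    ∃ A ≥ (0:ℝ), ∃ D ≥ (0:ℝ), ∀ k ∈ coneHull (Set.range fun t : T => (dg t, dg t xb - g t xb)),
      0 ≤ k.2 - k.1 xb ∧ ‖k.1‖ ≤ A * (k.2 - k.1 xb) - D * k.1 xt := by
  obtain ⟨ε, hε, δ, hδ, hp⟩ := hpm
  set N : ℝ := max M 0 with hN
  have hN0 : 0 ≤ N := le_max_right _ _
  have hMN : ∀ t, ‖dg t‖ ≤ N := fun t => (hM t).trans (le_max_left _ _)
  have el : ∀ t, 1 ≤ ((1 + N * ‖xt‖ / δ) / ε) * (-g t xb) - 1 / δ * dg t xt := by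
    intro t
    have hg := hg0 t
    by_cases hc : -ε ≤ g t xb
    · have h1 := hp t hc
      have h2 : 1 ≤ 1 / δ * (-dg t xt) := by
        rw [one_div_mul_eq_div, le_div_iff₀ hδ]; linarith
      have h3 : 0 ≤ ((1 + N * ‖xt‖ / δ) / ε) * (-g t xb) :=
        mul_nonneg (by positivity) (by linarith)
      linarith
    · push Not at hc
      have h1 : dg t xt ≤ N * ‖xt‖ :=
        (le_abs_self _).trans (((dg t).le_opNorm _).trans
          (mul_le_mul_of_nonneg_right (hMN t) (norm_nonneg _)))
      have h2 : (1 + N * ‖xt‖ / δ) ≤ ((1 + N * ‖xt‖ / δ) / ε) * (-g t xb) := by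
        rw [div_mul_eq_mul_div, le_div_iff₀ hε]
        exact mul_le_mul_of_nonneg_left (by linarith) (by positivity)
      have h3 : 1 / δ * dg t xt ≤ N * ‖xt‖ / δ := by
        rw [one_div_mul_eq_div]; gcongr
      linarith
  refine ⟨N * ((1 + N * ‖xt‖ / δ) / ε), by positivity, N * (1 / δ), by positivity, ?_⟩
  rintro k ⟨n, c, v, hc, hv, rfl⟩
  choose t ht using hv
  have e1 : (∑ i, c i • v i).1 = ∑ i, c i • dg (t i) := by
    rw [Prod.fst_sum]; exact Finset.sum_congr rfl fun i _ => by rw [← ht i]; rfl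
  have e2 : (∑ i, c i • v i).2 = ∑ i, c i * (dg (t i) xb - g (t i) xb) := by
    rw [Prod.snd_sum]; exact Finset.sum_congr rfl fun i _ => by rw [← ht i]; rfl
  have e3 : (∑ i, c i • v i).2 - (∑ i, c i • v i).1 xb = ∑ i, c i * (-g (t i) xb) := by
    rw [e1, e2]
    simp only [ContinuousLinearMap.sum_apply, ContinuousLinearMap.smul_apply, smul_eq_mul,
      ← Finset.sum_sub_distrib]
    exact Finset.sum_congr rfl fun i _ => by ring
  rw [e3, e1]
  refine ⟨Finset.sum_nonneg fun i _ => mul_nonneg (hc i) (by linarith [hg0 (t i)]), ?_⟩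
  simp only [ContinuousLinearMap.sum_apply, ContinuousLinearMap.smul_apply, smul_eq_mul,
      Finset.mul_sum, ← Finset.sum_sub_distrib]
  refine (norm_sum_le _ _).trans (Finset.sum_le_sum fun i _ => ?_)
  rw [norm_smul, Real.norm_of_nonneg (hc i)]
  calc c i * ‖dg (t i)‖ ≤ c i * (N * 1) := by
        rw [mul_one]; exact mul_le_mul_of_nonneg_left (hMN _) (hc i)
    _ ≤ c i * (N * (((1 + N * ‖xt‖ / δ) / ε) * (-g (t i) xb) - 1 / δ * dg (t i) xt)) :=
        mul_le_mul_of_nonneg_left (mul_le_mul_of_nonneg_left (el _) hN0) (hc i)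
    _ = _ := by ring

/-- Extraction of multipliers from an element of the cone. -/
theorem aux_mult {X T : Type*} [NormedAddCommGroup X] [NormedSpace ℝ X]
    (g : T → X → ℝ) (dg : T → X →L[ℝ] ℝ) (xb : X) (hg0 : ∀ t, g t xb ≤ 0)
    (k : (X →L[ℝ] ℝ) × ℝ)
    (hk : k ∈ coneHull (Set.range fun t : T => (dg t, dg t xb - g t xb)))
    (hk0 : k.2 - k.1 xb = 0) :
    ∃ lam : T → ℝ, (Function.support lam).Finite ∧ (∀ t : T, 0 ≤ lam t) ∧
      (∀ t : T, g t xb ≠ 0 → lam t = 0) ∧ k.1 = ∑ᶠ t : T, lam t • dg t := by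
  obtain ⟨n, c, v, hc, hv, rfl⟩ := hk
  choose t ht using hv
  have e1 : (∑ i, c i • v i).1 = ∑ i, c i • dg (t i) := by
    rw [Prod.fst_sum]; exact Finset.sum_congr rfl fun i _ => by rw [← ht i]; rfl
  have e2 : (∑ i, c i • v i).2 = ∑ i, c i * (dg (t i) xb - g (t i) xb) := by
    rw [Prod.snd_sum]; exact Finset.sum_congr rfl fun i _ => by rw [← ht i]; rfl
  have e3 : (∑ i, c i • v i).2 - (∑ i, c i • v i).1 xb = ∑ i, c i * (-g (t i) xb) := by
    rw [e1, e2]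
    simp only [ContinuousLinearMap.sum_apply, ContinuousLinearMap.smul_apply, smul_eq_mul,
      ← Finset.sum_sub_distrib]
    exact Finset.sum_congr rfl fun i _ => by ring
  rw [e3, Finset.sum_eq_zero_iff_of_nonneg
    (fun i _ => mul_nonneg (hc i) (by linarith [hg0 (t i)]))] at hk0
  classical
  let L : T →₀ ℝ := ∑ i, Finsupp.single (t i) (c i)
  have hL : ∀ s, L s = ∑ i, if t i = s then c i else 0 := by
    intro s
    simp [L, Finsupp.finsetSum_apply, Finsupp.single_apply]
  refine ⟨L, L.finite_support, ?_, ?_, ?_⟩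
  · intro s
    rw [hL]
    exact Finset.sum_nonneg fun i _ => by split_ifs <;> simp [hc i]
  · intro s hs
    rw [hL]
    refine Finset.sum_eq_zero fun i _ => ?_
    split_ifs with h
    · subst h
      have := hk0 i (Finset.mem_univ i)
      rcases mul_eq_zero.1 this with h | h
      · exact h
      · exact absurd (neg_eq_zero.1 h) hs
    · rfl
  · rw [e1, finsum_eq_sum_of_support_subset (s := L.support)]
    · have : Finsupp.linearCombination ℝ dg L = ∑ i, c i • dg (t i) := by
        simp [L, map_sum, Finsupp.linearCombination_single]
      rw [← this, Finsupp.linearCombination_apply]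
      rfl
    · intro s hs
      simp only [Function.mem_support] at hs
      simp only [Finset.mem_coe, Finsupp.mem_support_iff]
      intro h
      exact hs (by simp [h])

/-- The embedding of `X* × ℝ` into the weak* dual times `ℝ`. -/
def auxPhi (X : Type*) [NormedAddCommGroup X] [NormedSpace ℝ X] :
    ((X →L[ℝ] ℝ) × ℝ) →ₗ[ℝ] WeakDual ℝ X × ℝ where
  toFun := fun p => (toWD p.1, p.2)
  map_add' := fun _ _ => rfl
  map_smul' := fun _ _ => rfl

theorem aux_dual_rep {X : Type*} [NormedAddCommGroup X] [NormedSpace ℝ X]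
    (l : WeakDual ℝ X × ℝ →L[ℝ] ℝ) :
    ∃ (d : X) (α : ℝ), ∀ (p : WeakDual ℝ X) (r : ℝ), l (p, r) = p d + r * α := by
  obtain ⟨d, hd⟩ := LinearMap.dualEmbedding_surjective (topDualPairing ℝ X)
    (l.comp (ContinuousLinearMap.inl ℝ (WeakDual ℝ X) ℝ))
  refine ⟨d, l (0, 1), fun p r => ?_⟩
  have h1 : p d = l (p, 0) := DFunLike.congr_fun hd p
  have h2 : ((p, r) : WeakDual ℝ X × ℝ) = (p, 0) + r • (0, 1) := by simp
  rw [h2, map_add, map_smul, h1, smul_eq_mul]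

/-- differential KKT: if `xb` is a local minimizer of `f` over
`Ω = {x | h x = 0, g t x ≤ 0 ∀ t}`, the PMFCQ and the NFMCQ hold at `xb`, `{g t}` is uniformly
Fréchet differentiable at `xb`, and `f` is Fréchet differentiable at `xb`, then there are
multipliers `lam t ≥ 0`, nonzero for at most finitely many `t`, vanishing off the active set
`T(xb)`, and `q ∈ Y*` with `0 = ∇f(xb) + Σ_t lam t • dg t + ∇h(xb)* q`. -/
theorem statement18 {X Y T : Type*} [NormedAddCommGroup X] [NormedSpace ℝ X] [CompleteSpace X]
    [NormedAddCommGroup Y] [NormedSpace ℝ Y] [CompleteSpace Y]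
    (f : X → ℝ) (df : X →L[ℝ] ℝ) (g : T → X → ℝ) (dg : T → X →L[ℝ] ℝ)
    (h : X → Y) (dh : X →L[ℝ] Y) (xb : X)
    (hgd : ∀ t : T, HasFDerivAt (g t) (dg t) xb)
    (hhd : HasStrictFDerivAt h dh xb)
    (hbd : ∃ M : ℝ, ∀ t : T, ‖dg t‖ ≤ M)
    (hxb : xb ∈ {x : X | h x = 0 ∧ ∀ t : T, g t x ≤ 0})
    (hmin : ∃ ρ > (0:ℝ), ∀ x ∈ {x : X | h x = 0 ∧ ∀ t : T, g t x ≤ 0},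
      ‖x - xb‖ < ρ → f xb ≤ f x)
    (hsurj : Function.Surjective dh)
    (hpmfcq : ∃ xt : X, dh xt = 0 ∧ PMFCQat g dg xb xt)
    (hnfmcq : IsWeakStarClosedProd (coneHull (Set.range fun t : T => (dg t, dg t xb - g t xb))))
    (hunif : UnifFrechetDiffAt g dg xb)
    (hfd : HasFDerivAt f df xb) :
    ∃ (lam : T → ℝ) (q : Y →L[ℝ] ℝ),
      (Function.support lam).Finite ∧ (∀ t : T, 0 ≤ lam t) ∧
      (∀ t : T, g t xb ≠ 0 → lam t = 0) ∧
      (0 : X →L[ℝ] ℝ) = df + (∑ᶠ t : T, lam t • dg t) + q.comp dh := by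
  obtain ⟨M, hM⟩ := hbd
  obtain ⟨h0, hg0⟩ := hxb
  obtain ⟨xt, hxt, hpm⟩ := hpmfcq
  set K := coneHull (Set.range fun t : T => (dg t, dg t xb - g t xb)) with hK
  let C : Set (WeakDual ℝ X × ℝ) := auxPhi X '' K
  have hCcl : IsClosed C := hnfmcq
  let N : Submodule ℝ (WeakDual ℝ X × ℝ) :=
    { carrier := {z | (∀ x, dh x = 0 → z.1 x = 0) ∧ z.2 = z.1 xb}
      zero_mem' := ⟨fun x _ => rfl, rfl⟩
      add_mem' := by
        rintro a b ⟨ha, ha'⟩ ⟨hb, hb'⟩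
        refine ⟨fun x hx => ?_, ?_⟩
        · change a.1 x + b.1 x = 0
          rw [ha x hx, hb x hx, add_zero]
        · change a.2 + b.2 = a.1 xb + b.1 xb
          rw [ha', hb']
      smul_mem' := by
        rintro c a ⟨ha, ha'⟩
        refine ⟨fun x hx => ?_, ?_⟩
        · change c * a.1 x = 0
          rw [ha x hx, mul_zero]
        · change c * a.2 = c * a.1 xb
          rw [ha'] }
  have hev : ∀ x : X, Continuous fun z : WeakDual ℝ X × ℝ => z.1 x := fun x =>
    (WeakDual.eval_continuous x).comp continuous_fst
  have hNcl : IsClosed (N : Set (WeakDual ℝ X × ℝ)) := by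
    have : (N : Set (WeakDual ℝ X × ℝ)) =
        (⋂ x, ⋂ (_ : dh x = 0), {z | z.1 x = 0}) ∩ {z | z.2 = z.1 xb} := by
      ext z; simp [N]
    rw [this]
    refine IsClosed.inter (isClosed_iInter fun x => isClosed_iInter fun _ => ?_) ?_
    · exact isClosed_eq (hev x) continuous_const
    · exact isClosed_eq continuous_snd (hev xb)
  let z0 : WeakDual ℝ X × ℝ := auxPhi X (-df, -df xb)
  -- Step 1: `z0` is in the closure of `C + N`
  have hz0 : z0 ∈ closure (C + (N : Set (WeakDual ℝ X × ℝ))) := by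
    by_contra hcon
    have hconv : Convex ℝ (C + (N : Set (WeakDual ℝ X × ℝ))) :=
      ((aux_cone_convex _).linear_image (auxPhi X)).add N.convex
    haveI : LocallyConvexSpace ℝ (WeakDual ℝ X) :=
      (WeakDual.withSeminorms ℝ X).toLocallyConvexSpace
    obtain ⟨l, u, hl, hlz⟩ := geometric_hahn_banach_closed_point hconv.closure isClosed_closure hcon
    obtain ⟨d, α, hrep⟩ := aux_dual_rep l
    have hlS : ∀ k ∈ K, ∀ n ∈ N, l (auxPhi X k) + l n < u := by
      intro k hk n hn
      rw [← map_add]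
      exact hl _ (subset_closure (Set.add_mem_add ⟨k, hk, rfl⟩ hn))
    have hu : 0 < u := by
      have := hlS 0 (aux_cone_zero _) 0 N.zero_mem
      simpa using this
    have hK0 : ∀ k ∈ K, l (auxPhi X k) ≤ 0 := by
      intro k hk
      by_contra hpos
      push Not at hpos
      have := hlS ((u / l (auxPhi X k)) • k) (aux_cone_smul hk (by positivity)) 0 N.zero_mem
      simp only [map_smul, map_zero, add_zero, smul_eq_mul] at this
      rw [div_mul_cancel₀ _ hpos.ne'] at this
      exact lt_irrefl _ this
    have hN0 : ∀ n ∈ N, l n = 0 := by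
      intro n hn
      by_contra hne
      have := hlS 0 (aux_cone_zero _) ((u / l n) • n) (N.smul_mem _ hn)
      simp only [map_smul, map_zero, zero_add, smul_eq_mul] at this
      rw [div_mul_cancel₀ _ hne] at this
      exact lt_irrefl _ this
    set d' : X := d + α • xb with hd'
    have hddh : dh d' = 0 := by
      refine NormedSpace.eq_zero_of_forall_dual_eq_zero ℝ fun q => ?_
      have := hN0 (auxPhi X (q.comp dh, q (dh xb)))
        ⟨fun x hx => by change q (dh x) = 0; rw [hx, map_zero], rfl⟩
      change l (toWD (q.comp dh), q (dh xb)) = 0 at this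
      rw [hrep] at this
      change q (dh d) + q (dh xb) * α = 0 at this
      rw [hd']
      simp only [map_add, map_smul, smul_eq_mul]
      linarith
    have hdt : ∀ t, dg t d' ≤ α * g t xb := by
      intro t
      have := hK0 _ (aux_cone_single ⟨t, rfl⟩)
      change l (toWD (dg t), dg t xb - g t xb) ≤ 0 at this
      rw [hrep] at this
      change dg t d + (dg t xb - g t xb) * α ≤ 0 at this
      rw [hd']
      simp only [map_add, map_smul, smul_eq_mul]
      linarith
    have hdf := aux_primal f df g dg h dh xb hhd M hM h0 hg0 hmin hsurj xt hxt hpm hunif hfd d'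
      hddh (-α) (by simpa using hdt)
    have h3 : l z0 = -df d + (-df xb) * α := hrep _ _
    rw [hd'] at hdf
    simp only [map_add, map_smul, smul_eq_mul] at hdf
    linarith
  -- Step 2: `z0` belongs to `C + N`
  obtain ⟨A, hA, D, hD, hbound⟩ := aux_bound g dg xb xt M hM hg0 hpm
  set R : ℝ := A * 1 + D * (df xt + 1) with hR
  let B : Set (WeakDual ℝ X × ℝ) :=
    (WeakDual.toStrongDual ⁻¹' Metric.closedBall (0 : X →L[ℝ] ℝ) R) ×ˢ
      Set.Icc (-(R * ‖xb‖)) (1 + R * ‖xb‖)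
  have hB : IsCompact B := (WeakDual.isCompact_closedBall 0 R).prod isCompact_Icc
  have hCB : IsCompact (C ∩ B) := hB.inter_left hCcl
  have hcl : IsClosed (C ∩ B + (N : Set (WeakDual ℝ X × ℝ))) := hNcl.add_left_of_isCompact hCB
  let U : Set (WeakDual ℝ X × ℝ) := {z | z.2 - z.1 xb < 1} ∩ {z | -df xt - 1 < z.1 xt}
  have hU : IsOpen U :=
    (isOpen_lt (continuous_snd.sub (hev xb)) continuous_const).inter
      (isOpen_lt continuous_const (hev xt))
  have hz0U : z0 ∈ U := by
    constructor
    · change -df xb - (-df xb) < 1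
      linarith
    · change -df xt - 1 < -df xt
      linarith
  have hsub : (C + (N : Set (WeakDual ℝ X × ℝ))) ∩ U ⊆
      C ∩ B + (N : Set (WeakDual ℝ X × ℝ)) := by
    rintro z ⟨⟨_, ⟨k, hk, rfl⟩, n, hn, rfl⟩, hz1, hz2⟩
    refine Set.add_mem_add ⟨⟨k, hk, rfl⟩, ?_⟩ hn
    change k.2 + n.2 - (k.1 xb + n.1 xb) < 1 at hz1
    change -df xt - 1 < k.1 xt + n.1 xt at hz2
    rw [hn.2] at hz1
    rw [hn.1 xt hxt] at hz2
    obtain ⟨hb1, hb2⟩ := hbound k hk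
    have hkR : ‖k.1‖ ≤ R := by
      refine hb2.trans ?_
      rw [hR]
      nlinarith
    have habs : |k.1 xb| ≤ R * ‖xb‖ :=
      (k.1.le_opNorm xb).trans (mul_le_mul_of_nonneg_right hkR (norm_nonneg _))
    have habs := abs_le.1 habs
    refine ⟨?_, ?_, ?_⟩
    · change k.1 ∈ Metric.closedBall (0 : X →L[ℝ] ℝ) R
      simpa using hkR
    · change -(R * ‖xb‖) ≤ k.2
      linarith
    · change k.2 ≤ 1 + R * ‖xb‖
      linarith
  have hz0' : z0 ∈ C ∩ B + (N : Set (WeakDual ℝ X × ℝ)) := by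
    refine closure_minimal hsub hcl ?_
    rw [Set.inter_comm]
    exact hU.inter_closure ⟨hz0U, hz0⟩
  obtain ⟨_, ⟨⟨k, hk, rfl⟩, _⟩, n, hn, hsum⟩ := hz0'
  have hs1 : ∀ x, k.1 x + n.1 x = -df x := fun x =>
    DFunLike.congr_fun (congrArg Prod.fst hsum) x
  have hs2 : k.2 + n.2 = -df xb := congrArg Prod.snd hsum
  have hk0 : k.2 - k.1 xb = 0 := by
    have := hs1 xb
    rw [hn.2] at hs2
    linarith
  obtain ⟨lam, hl1, hl2, hl3, hl4⟩ := aux_mult g dg xb hg0 k hk hk0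
  obtain ⟨q, hq⟩ := aux_factor dh hsurj (WeakDual.toStrongDual n.1) hn.1
  refine ⟨lam, q, hl1, hl2, hl3, ?_⟩
  rw [← hl4, ← hq]
  ext x
  change 0 = df x + k.1 x + n.1 x
  linarith [hs1 x]
end

section
/- Consider the convex infinite program: minimize f(x) subject to g_t(x) ≤ 0 (t ∈ T) and Ax = 0, where all g_t are convex and uniformly Fréchet differentiable at x̄ ∈ Ω, A is a surjective continuous linear operator, and f is convex and continuous at some point of Ω. If the PMFCQ (equivalently, the SSC) holds at x̄, then x̄ is a global minimizer of f over Ω if and only if 0 ∈ ∂f(x̄) + ⋂_{ε>0} cl* cone{∇g_t(x̄) : t ∈ T_ε(x̄)} + A*(Y*). If in addition the NFMCQ holds at x̄, then x̄ is a global minimizer if and only if there exist nonnegative multipliers λ = (λ_t)_{t∈T} with λ_t ≠ 0 for at most finitely many t, λ_t = 0 for t ∉ T(x̄), and y* ∈ Y* such that 0 ∈ ∂f(x̄) + Σ_{t∈T(x̄)} λ_t ∇g_t(x̄) + A*y*. -/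
open Filter Topology Set Pointwise

section Aux

variable {X Y T : Type*} [NormedAddCommGroup X] [NormedSpace ℝ X] [NormedAddCommGroup Y] [NormedSpace ℝ Y]

theorem aux_dual (φ : WeakDual ℝ X →L[ℝ] ℝ) : ∃ z : X, ∀ u : WeakDual ℝ X, φ u = u z := by
  obtain ⟨z, hz⟩ := LinearMap.dualEmbedding_surjective (topDualPairing ℝ X) φ
  exact ⟨z, fun u => by rw [← hz]; rfl⟩

theorem aux_lcs : LocallyConvexSpace ℝ (WeakDual ℝ X) :=
  (WeakDual.withSeminorms ℝ X).toLocallyConvexSpace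

theorem coneHull_convex {E : Type*} [AddCommGroup E] [Module ℝ E] (S : Set E) :
    Convex ℝ (coneHull S) := by
  rintro x ⟨n, c, v, hc, hv, rfl⟩ y ⟨m, d, w, hd, hw, rfl⟩ a b ha hb _
  refine ⟨n + m, Fin.append (a • c) (b • d), Fin.append v w, ?_, ?_, ?_⟩
  · intro i
    refine Fin.addCases (fun i => ?_) (fun i => ?_) i
    · simpa using mul_nonneg ha (hc i)
    · simpa using mul_nonneg hb (hd i)
  · intro i
    refine Fin.addCases (fun i => ?_) (fun i => ?_) i
    · simpa using hv i
    · simpa using hw i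
  · simp [Fin.sum_univ_add, Finset.smul_sum, smul_smul]

theorem coneHull_smul_mem {E : Type*} [AddCommGroup E] [Module ℝ E] {S : Set E} {a : ℝ} (ha : 0 ≤ a) {x : E} (hx : x ∈ S) :
    a • x ∈ coneHull S :=
  ⟨1, fun _ => a, fun _ => x, fun _ => ha, fun _ => hx, by simp⟩

theorem coneHull_zero_mem {E : Type*} [AddCommGroup E] [Module ℝ E] {S : Set E} :
    (0:E) ∈ coneHull S :=
  ⟨0, fun _ => 0, fun _ => 0, fun _ => le_rfl, fun i => i.elim0, by simp⟩

theorem coneHull_mono {E : Type*} [AddCommGroup E] [Module ℝ E] {S S' : Set E} (h : S ⊆ S') :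
    coneHull S ⊆ coneHull S' := by
  rintro x ⟨n, c, v, hc, hv, rfl⟩
  exact ⟨n, c, v, hc, fun i => h (hv i), rfl⟩

/-- annihilator of the kernel is the adjoint range -/
theorem aux_annihilator [CompleteSpace X] [CompleteSpace Y] (A : X →L[ℝ] Y)
    (hA : Function.Surjective A) (p : X →L[ℝ] ℝ) (hp : ∀ z, A z = 0 → p z = 0) :
    ∃ q : Y →L[ℝ] ℝ, p = q.comp A := by
  obtain ⟨q, hq⟩ : ∃ q : Y →ₗ[ℝ] ℝ, ∀ x, q (A x) = p x := by
    have hs : LinearMap.ker (A : X →ₗ[ℝ] Y) ≤ LinearMap.ker (p : X →ₗ[ℝ] ℝ) := by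
      intro z hz
      simpa using hp z (by simpa using hz)
    let e := (A : X →ₗ[ℝ] Y).quotKerEquivOfSurjective hA
    refine ⟨((LinearMap.ker (A : X →ₗ[ℝ] Y)).liftQ (p : X →ₗ[ℝ] ℝ) hs).comp e.symm.toLinearMap, fun x => ?_⟩
    have : e.symm (A x) = Submodule.Quotient.mk x := by
      rw [LinearEquiv.symm_apply_eq]; rfl
    simp [this]
  have hc : Continuous q := by
    rw [(A.isQuotientMap hA).continuous_iff]
    have : (q ∘ A) = p := funext hq
    rw [this]; exact p.continuous
  exact ⟨⟨q, hc⟩, by ext x; exact (hq x).symm⟩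

theorem aux_grad {g : T → X → ℝ} {dg : T → X →L[ℝ] ℝ} {xb : X}
    (hconv : ∀ t : T, ConvexOn ℝ univ (g t)) (hunif : UnifFrechetDiffAt g dg xb) (t : T) (x : X) :
    dg t (x - xb) ≤ g t x - g t xb := by
  refine le_of_forall_pos_le_add fun e he => ?_
  set N := ‖x - xb‖ + 1 with hN
  have hN0 : 0 < N := by positivity
  obtain ⟨η, hη, h⟩ := hunif (e / N) (by positivity)
  set s := min 1 (η / N) with hs
  have hs0 : 0 < s := by positivity
  have hs1 : s ≤ 1 := min_le_left _ _
  have hs2 : s * N ≤ η := by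
    have : s ≤ η / N := min_le_right _ _
    rwa [le_div_iff₀ hN0] at this
  have h1 := h t (xb + s • (x - xb)) (by
    rw [add_sub_cancel_left, norm_smul, Real.norm_of_nonneg hs0.le]
    nlinarith [norm_nonneg (x - xb)])
  rw [add_sub_cancel_left, norm_smul, Real.norm_of_nonneg hs0.le, map_smul, smul_eq_mul] at h1
  have h2 := (hconv t).2 (mem_univ xb) (mem_univ x) (by linarith : 0 ≤ 1 - s) hs0.le (by ring)
  have h3 : (1 - s) • xb + s • x = xb + s • (x - xb) := by module
  rw [h3, smul_eq_mul, smul_eq_mul] at h2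
  have h4 := (abs_le.1 h1).1
  have h5 : e / N * (s * ‖x - xb‖) ≤ s * e := by
    have : e / N * ‖x - xb‖ ≤ e := by
      rw [div_mul_eq_mul_div, div_le_iff₀ hN0]; nlinarith
    nlinarith
  have : s * dg t (x - xb) ≤ s * (g t x - g t xb + e) := by nlinarith
  exact le_of_mul_le_mul_left this hs0

theorem aux_feas_s19 {g : T → X → ℝ} {dg : T → X →L[ℝ] ℝ} {xb : X} {M : ℝ} (hM : ∀ t, ‖dg t‖ ≤ M) (hM0 : 0 ≤ M)
    (hunif : UnifFrechetDiffAt g dg xb) (hxb : ∀ t, g t xb ≤ 0) {ε c : ℝ} (hε : 0 < ε) (hc : 0 < c) (z : X)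
    (hz : ∀ t, -ε ≤ g t xb → dg t z ≤ -c) :
    ∃ s > (0:ℝ), ∀ t, g t (xb + s • z) ≤ 0 := by
  set N := ‖z‖ + 1 with hN
  have hN0 : 0 < N := by positivity
  obtain ⟨η, hη, h⟩ := hunif (c / N) (by positivity)
  set s := min (η / N) (ε / (M * N + c)) with hs
  have hs0 : 0 < s := by positivity
  have hs1 : s * N ≤ η := by
    have : s ≤ η / N := min_le_left _ _
    rwa [le_div_iff₀ hN0] at this
  have hs2 : s * (M * N + c) ≤ ε := by
    have : s ≤ ε / (M * N + c) := min_le_right _ _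
    rwa [le_div_iff₀ (by positivity)] at this
  refine ⟨s, hs0, fun t => ?_⟩
  have h1 := h t (xb + s • z) (by
    rw [add_sub_cancel_left, norm_smul, Real.norm_of_nonneg hs0.le]
    nlinarith [norm_nonneg z])
  rw [add_sub_cancel_left, norm_smul, Real.norm_of_nonneg hs0.le, map_smul, smul_eq_mul] at h1
  have h4 := (abs_le.1 h1).2
  have h5 : c / N * (s * ‖z‖) ≤ s * c := by
    have : c / N * ‖z‖ ≤ c := by
      rw [div_mul_eq_mul_div, div_le_iff₀ hN0]; nlinarith
    nlinarith
  by_cases ht : -ε ≤ g t xb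
  · have := hz t ht
    have := hxb t
    nlinarith
  · have h6 : dg t z ≤ M * N := by
      calc dg t z ≤ ‖dg t z‖ := Real.le_norm_self _
        _ ≤ ‖dg t‖ * ‖z‖ := (dg t).le_opNorm z
        _ ≤ M * N := mul_le_mul (hM t) (by linarith) (norm_nonneg _) hM0
    push Not at ht
    nlinarith

theorem aux_sum {f : X → ℝ} (hf : ConvexOn ℝ univ f) (hfc : ∃ x₀, ContinuousAt f x₀) {Ω : Set X} (hΩ : Convex ℝ Ω)
    {xb : X} (hxb : xb ∈ Ω) (hmin : ∀ x ∈ Ω, f xb ≤ f x) :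
    ∃ p ∈ convexSubdiff f xb, ∀ x ∈ Ω, 0 ≤ p (x - xb) := by
  have hcont : Continuous f := by
    obtain ⟨x₀, h₀⟩ := hfc
    have h := (hf.continuousOn_tfae isOpen_univ ⟨x₀, mem_univ _⟩).out 2 1
    rw [continuousOn_univ] at h
    exact h.1 ⟨x₀, mem_univ _, h₀⟩
  have hepi : Convex ℝ {q : X × ℝ | f q.1 < q.2} := by
    have := hf.convex_strict_epigraph
    simpa using this
  have hopen : IsOpen {q : X × ℝ | f q.1 < q.2} :=
    isOpen_lt (hcont.comp continuous_fst) continuous_snd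
  have hC : Convex ℝ (Ω ×ˢ Iic (f xb)) := hΩ.prod (convex_Iic _)
  obtain ⟨φ, s, h1, h2⟩ := geometric_hahn_banach_open hepi hopen hC (by
    rw [Set.disjoint_left]
    rintro ⟨x, r⟩ hx ⟨hx1, hx2⟩
    have := hmin x hx1
    simp at hx hx2
    linarith)
  set ψ : X →L[ℝ] ℝ := φ.comp (ContinuousLinearMap.inl ℝ X ℝ) with hψ
  set β : ℝ := φ (0, 1) with hβ
  have hφ : ∀ x r, φ (x, r) = ψ x + r * β := by
    intro x r
    have : ((x, r) : X × ℝ) = (x, 0) + r • (0, 1) := by simp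
    rw [this, map_add, map_smul, smul_eq_mul]; rfl
  have hβ0 : β < 0 := by
    have a := h1 (xb, f xb + 1) (by simp)
    have b := h2 (xb, f xb) ⟨hxb, by simp⟩
    rw [hφ] at a b
    linarith
  have key : ∀ x, ψ x + f x * β ≤ s := by
    intro x
    refine le_of_forall_pos_le_add fun e he => ?_
    have a := h1 (x, f x + e / (-β)) (by
      have : 0 < e / (-β) := div_pos he (by linarith)
      simpa using this)
    rw [hφ] at a
    have : e / (-β) * β = -e := by
      have := hβ0.ne
      field_simp
    nlinarith
  have key2 : ∀ y ∈ Ω, s ≤ ψ y + f xb * β := by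
    intro y hy
    have b := h2 (y, f xb) ⟨hy, by simp⟩
    rwa [hφ] at b
  have hb' : 0 < (-β)⁻¹ := inv_pos.2 (by linarith)
  have hbb : (-β)⁻¹ * β = -1 := by
    have := hβ0.ne
    field_simp
  refine ⟨(-β)⁻¹ • ψ, fun x => ?_, fun y hy => ?_⟩
  · have a := key x
    have b := key2 xb hxb
    have : (-β)⁻¹ * (ψ x + f x * β) ≤ (-β)⁻¹ * (ψ xb + f xb * β) :=
      mul_le_mul_of_nonneg_left (a.trans b) hb'.le
    simp only [_root_.smul_apply, map_sub, smul_eq_mul]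
    have e1 : (-β)⁻¹ * (f x * β) = - f x := by rw [mul_left_comm, hbb]; ring
    have e2 : (-β)⁻¹ * (f xb * β) = - f xb := by rw [mul_left_comm, hbb]; ring
    rw [mul_add, mul_add, e1, e2] at this
    linarith
  · have a := key xb
    have b := key2 y hy
    simp only [_root_.smul_apply, map_sub, smul_eq_mul]
    rw [← mul_sub]
    exact mul_nonneg hb'.le (by linarith)

theorem toWD_convex {S : Set (X →L[ℝ] ℝ)} (hS : Convex ℝ S) : Convex ℝ (toWD '' S) := by
  rintro _ ⟨x, hx, rfl⟩ _ ⟨y, hy, rfl⟩ a b ha hb hab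
  exact ⟨a • x + b • y, hS hx hy ha hb hab, rfl⟩

/-- The affine slice: functionals agreeing with `w` on `ker A`. -/
theorem aux_slice_nonempty {g : T → X → ℝ} {dg : T → X →L[ℝ] ℝ} {A : X →L[ℝ] Y} {xb xt : X} {M : ℝ}
    (hM : ∀ t, ‖dg t‖ ≤ M) (hM0 : 0 ≤ M)
    (hunif : UnifFrechetDiffAt g dg xb) (hAxb : A xb = 0) (hxb : ∀ t, g t xb ≤ 0)
    (hAxt : A xt = 0) {ε δ : ℝ} (hε : 0 < ε) (hδ : 0 < δ)
    (hxt : ∀ t, -ε ≤ g t xb → dg t xt ≤ -δ)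
    (w : X →L[ℝ] ℝ) (hw : ∀ x, A x = 0 → (∀ t, g t x ≤ 0) → w (x - xb) ≤ 0)
    {K : ℝ} (hK : 0 < K) (hK' : |w xt| + 1 ≤ K * δ) :
    ((closure (toWD '' coneHull (dg '' {t : T | -ε ≤ g t xb})) ∩
      WeakDual.toStrongDual ⁻¹' Metric.closedBall (0 : X →L[ℝ] ℝ) (K * M)) ∩
      {u : WeakDual ℝ X | ∀ z, A z = 0 → u z = w z}).Nonempty := by
  rw [Set.nonempty_iff_ne_empty]
  intro hempty
  have := aux_lcs (X := X)
  set S := coneHull (dg '' {t : T | -ε ≤ g t xb}) with hS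
  have hSc : Convex ℝ S := coneHull_convex _
  have hb : Convex ℝ ((WeakDual.toStrongDual : WeakDual ℝ X ≃ₗ[ℝ] _) ⁻¹' Metric.closedBall (0 : X →L[ℝ] ℝ) (K * M)) :=
    (convex_closedBall (0 : X →L[ℝ] ℝ) (K * M)).linear_preimage
      (WeakDual.toStrongDual : WeakDual ℝ X ≃ₗ[ℝ] _).toLinearMap
  have hL : Convex ℝ {u : WeakDual ℝ X | ∀ z, A z = 0 → u z = w z} := by
    intro x hx y hy a b _ _ hab z hz
    have e : (a • x + b • y) z = a * x z + b * y z := rfl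
    rw [e, hx z hz, hy z hz, ← add_mul, hab, one_mul]
  have hLc : IsClosed {u : WeakDual ℝ X | ∀ z, A z = 0 → u z = w z} := by
    simp only [Set.ofPred_forall]
    exact isClosed_iInter fun z => isClosed_iInter fun _ =>
      isClosed_eq (WeakDual.eval_continuous z) continuous_const
  obtain ⟨φ, r, v, h1, hrv, h2⟩ := geometric_hahn_banach_compact_closed
    ((toWD_convex hSc).closure.inter hb)
    ((WeakDual.isCompact_closedBall (0 : X →L[ℝ] ℝ) (K * M)).inter_left isClosed_closure)
    hL hLc (Set.disjoint_iff_inter_eq_empty.2 hempty)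
  obtain ⟨z, hz⟩ := aux_dual φ
  -- `z` is in the kernel of `A`
  have hAz : A z = 0 := by
    by_contra hne
    obtain ⟨q, hq⟩ : ∃ q : Y →L[ℝ] ℝ, q (A z) ≠ 0 := by
      obtain ⟨q, -, hq⟩ := exists_dual_vector ℝ (A z) (by simpa using hne)
      exact ⟨q, by rw [hq]; simpa using hne⟩
    set k := (v - w z) / q (A z) with hk
    have h3 := h2 (toWD (w + k • q.comp A)) (by
      intro y hy
      change w y + k * q (A y) = w y
      simp [hy])
    rw [hz] at h3
    change v < w z + k * q (A z) at h3
    rw [hk, div_mul_cancel₀ _ hq] at h3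
    linarith
  have h0 : 0 < r := by
    have := h1 (toWD 0) ⟨subset_closure ⟨0, coneHull_zero_mem, rfl⟩, by
      change (0 : X →L[ℝ] ℝ) ∈ Metric.closedBall 0 (K * M)
      simp; positivity⟩
    rw [hz] at this
    exact this
  have hwz : v < w z := by
    have := h2 (toWD w) (fun _ _ => rfl)
    rw [hz] at this
    exact this
  have ht : ∀ t, -ε ≤ g t xb → K * dg t z < r := by
    intro t ht
    have := h1 (toWD (K • dg t)) ⟨subset_closure ⟨K • dg t, coneHull_smul_mem hK.le ⟨t, ht, rfl⟩, rfl⟩, by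
      change K • dg t ∈ Metric.closedBall 0 (K * M)
      rw [mem_closedBall_zero_iff, norm_smul, Real.norm_of_nonneg hK.le]
      exact mul_le_mul_of_nonneg_left (hM t) hK.le⟩
    rw [hz] at this
    exact this
  -- corrected direction
  set ρ := w z / (K * δ) with hρ
  have hKδ : 0 < K * δ := by positivity
  have hwz0 : 0 < w z := by linarith
  have hρ0 : 0 < ρ := by positivity
  have hρ' : ρ * (K * δ) = w z := by rw [hρ, div_mul_cancel₀ _ hKδ.ne']
  obtain ⟨s, hs, hfeas⟩ := aux_feas_s19 hM hM0 hunif hxb hε (c := (w z - r) / K) (by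
      apply div_pos <;> linarith) (z + ρ • xt) (by
    intro t htt
    have a := ht t htt
    have b := hxt t htt
    rw [map_add, map_smul, smul_eq_mul]
    have : (w z - r) / K * K = w z - r := div_mul_cancel₀ _ hK.ne'
    have c : ρ * dg t xt ≤ ρ * (-δ) := mul_le_mul_of_nonneg_left b hρ0.le
    have d : K * (dg t z + ρ * dg t xt) ≤ K * (-((w z - r) / K)) := by nlinarith
    exact le_of_mul_le_mul_left d hK)
  have h5 := hw (xb + s • (z + ρ • xt)) (by simp [hAxb, hAz, hAxt]) hfeas
  rw [add_sub_cancel_left, map_smul, map_add, map_smul, smul_eq_mul, smul_eq_mul] at h5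
  have h6 : w z + ρ * w xt ≤ 0 := by
    by_contra hcon
    push Not at hcon
    nlinarith [mul_pos hs hcon]
  have h7 := neg_abs_le (w xt)
  nlinarith

theorem aux_normal [CompleteSpace X] [CompleteSpace Y] {g : T → X → ℝ} {dg : T → X →L[ℝ] ℝ} {A : X →L[ℝ] Y} {xb xt : X} {M : ℝ}
    (hM : ∀ t, ‖dg t‖ ≤ M) (hM0 : 0 ≤ M) (hsurj : Function.Surjective A)
    (hunif : UnifFrechetDiffAt g dg xb) (hAxb : A xb = 0) (hxb : ∀ t, g t xb ≤ 0)
    (hAxt : A xt = 0) {ε₀ δ : ℝ} (hε₀ : 0 < ε₀) (hδ : 0 < δ)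
    (hxt : ∀ t, -ε₀ ≤ g t xb → dg t xt ≤ -δ)
    (w : X →L[ℝ] ℝ) (hw : ∀ x, A x = 0 → (∀ t, g t x ≤ 0) → w (x - xb) ≤ 0) :
    ∃ u ∈ (⋂ ε > (0:ℝ), wkClosure (coneHull (dg '' {t : T | -ε ≤ g t xb}))),
      ∃ q : Y →L[ℝ] ℝ, w = u + q.comp A := by
  set K := (|w xt| + 1) / δ with hKd
  have hK : 0 < K := by positivity
  have hK' : |w xt| + 1 ≤ K * δ := by rw [hKd, div_mul_cancel₀ _ hδ.ne']
  have hLc : IsClosed {u : WeakDual ℝ X | ∀ z, A z = 0 → u z = w z} := by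
    simp only [Set.ofPred_forall]
    exact isClosed_iInter fun z => isClosed_iInter fun _ =>
      isClosed_eq (WeakDual.eval_continuous z) continuous_const
  let D : ℕ → Set (WeakDual ℝ X) := fun n =>
    ((closure (toWD '' coneHull (dg '' {t : T | -(ε₀ / (n + 1)) ≤ g t xb})) ∩
      WeakDual.toStrongDual ⁻¹' Metric.closedBall (0 : X →L[ℝ] ℝ) (K * M)) ∩
      {u : WeakDual ℝ X | ∀ z, A z = 0 → u z = w z})
  obtain ⟨u, hu⟩ := IsCompact.nonempty_iInter_of_sequence_nonempty_isCompact_isClosed D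
    (fun n => by
      refine inter_subset_inter_left _ (inter_subset_inter_left _ (closure_mono (image_mono
        (coneHull_mono (image_mono fun t ht => ?_)))))
      have : ε₀ / ((n + 1 : ℕ) + 1 : ℝ) ≤ ε₀ / (n + 1 : ℝ) := by
        push_cast
        gcongr
        linarith
      simp only [mem_ofPred_eq] at ht ⊢
      linarith)
    (fun n => by
      have hle : ε₀ / (n + 1 : ℝ) ≤ ε₀ := div_le_self hε₀.le (by
        have : (0:ℝ) ≤ n := n.cast_nonneg
        linarith)
      exact aux_slice_nonempty hM hM0 hunif hAxb hxb hAxt (ε := ε₀ / (n + 1)) (by positivity) hδ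
        (fun t ht => hxt t (by linarith)) w hw hK hK')
    (((WeakDual.isCompact_closedBall (0 : X →L[ℝ] ℝ) (K * M)).inter_left isClosed_closure).inter_right hLc)
    (fun n => (isClosed_closure.inter (WeakDual.isClosed_closedBall _ _)).inter hLc)
  rw [mem_iInter] at hu
  obtain ⟨q, hq⟩ := aux_annihilator A hsurj (w - WeakDual.toStrongDual u) (by
    intro z hz
    have := (hu 0).2 z hz
    change w z - u z = 0
    rw [this, sub_self])
  refine ⟨WeakDual.toStrongDual u, ?_, q, by rw [← hq]; abel⟩
  simp only [mem_iInter]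
  intro ε hε
  obtain ⟨n, hn⟩ := exists_nat_gt (ε₀ / ε)
  have hle : ε₀ / (n + 1 : ℝ) ≤ ε := by
    rw [div_lt_iff₀ hε] at hn
    rw [div_le_iff₀ (by positivity)]
    nlinarith
  change u ∈ closure _
  refine closure_mono (image_mono (coneHull_mono (image_mono fun t ht => ?_))) (hu n).1.1
  simp only [mem_ofPred_eq] at ht ⊢
  linarith

theorem aux_ineq {g : T → X → ℝ} {dg : T → X →L[ℝ] ℝ} {xb xt : X}
    (hconv : ∀ t : T, ConvexOn ℝ univ (g t)) (hunif : UnifFrechetDiffAt g dg xb)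
    {ε₀ δ : ℝ} (hε₀ : 0 < ε₀) (hδ : 0 < δ)
    (hxt : ∀ t, -ε₀ ≤ g t xb → dg t xt ≤ -δ) {u : X →L[ℝ] ℝ}
    (hu : u ∈ (⋂ ε > (0:ℝ), wkClosure (coneHull (dg '' {t : T | -ε ≤ g t xb}))))
    {x : X} (hx : ∀ t, g t x ≤ 0) : u (x - xb) ≤ 0 := by
  simp only [mem_iInter] at hu
  have key : ∀ ε > (0:ℝ), ε ≤ ε₀ → u (x - xb) ≤ ε * (-(u xt) / δ) := by
    intro ε hε hle
    have hcl : IsClosed {v : WeakDual ℝ X | v (x - xb) ≤ ε * (-(v xt) / δ)} :=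
      isClosed_le (WeakDual.eval_continuous _)
        (continuous_const.mul ((WeakDual.eval_continuous xt).neg.div_const _))
    refine closure_minimal ?_ hcl (hu ε hε)
    rintro _ ⟨_, ⟨n, c, v, hc, hv, rfl⟩, rfl⟩
    change (∑ i, c i • v i) (x - xb) ≤ ε * (-((∑ i, c i • v i) xt) / δ)
    simp only [_root_.sum_apply, _root_.smul_apply, smul_eq_mul]
    rw [← Finset.sum_neg_distrib, Finset.sum_div, Finset.mul_sum]
    refine Finset.sum_le_sum fun i _ => ?_
    obtain ⟨t, ht, hvt⟩ := hv i
    rw [← hvt]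
    simp only [mem_ofPred_eq] at ht
    have a := aux_grad hconv hunif t x
    have b := hxt t (by linarith)
    have d := hx t
    have e : 1 ≤ -(dg t xt) / δ := by rw [le_div_iff₀ hδ]; linarith
    have h1 : dg t (x - xb) ≤ ε * (-(dg t xt) / δ) := by nlinarith
    calc c i * dg t (x - xb) ≤ c i * (ε * (-(dg t xt) / δ)) := mul_le_mul_of_nonneg_left h1 (hc i)
      _ = _ := by ring
  set B := |-(u xt) / δ| + 1 with hB
  have hB0 : 0 < B := by positivity
  refine le_of_forall_pos_le_add fun e he => ?_
  have h := key (min ε₀ (e / B)) (by positivity) (min_le_left _ _)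
  have h2 : min ε₀ (e / B) * B ≤ e := by
    have : min ε₀ (e / B) ≤ e / B := min_le_right _ _
    rwa [le_div_iff₀ hB0] at this
  have h3 : 0 < min ε₀ (e / B) := by positivity
  have h4 := le_abs_self (-(u xt) / δ)
  nlinarith

theorem aux_nfm {g : T → X → ℝ} {dg : T → X →L[ℝ] ℝ} {xb xt : X} (hxb : ∀ t, g t xb ≤ 0)
    {ε₀ δ : ℝ} (hε₀ : 0 < ε₀) (hδ : 0 < δ)
    (hxt : ∀ t, -ε₀ ≤ g t xb → dg t xt ≤ -δ) {u : X →L[ℝ] ℝ}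
    (hu : u ∈ (⋂ ε > (0:ℝ), wkClosure (coneHull (dg '' {t : T | -ε ≤ g t xb}))))
    (hcl : IsWeakStarClosedProd (coneHull (Set.range fun t : T => (dg t, dg t xb - g t xb)))) :
    ∃ lam : T → ℝ, (Function.support lam).Finite ∧ (∀ t : T, 0 ≤ lam t) ∧
            (∀ t : T, g t xb ≠ 0 → lam t = 0) ∧ u = ∑ᶠ t : T, lam t • dg t := by
  simp only [mem_iInter] at hu
  have hmem : (toWD u, u xb) ∈ (fun p : (X →L[ℝ] ℝ) × ℝ => (toWD p.1, p.2)) ''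
      (coneHull (Set.range fun t : T => (dg t, dg t xb - g t xb))) := by
    rw [← IsClosed.closure_eq hcl, mem_closure_iff_nhds]
    intro N hN
    rw [nhds_prod_eq, mem_prod_iff] at hN
    obtain ⟨N₁, hN₁, N₂, hN₂, hsub⟩ := hN
    obtain ⟨r, hr, hball⟩ := Metric.mem_nhds_iff.1 hN₂
    set B := (|u xt| + 1) / δ with hB
    have hB0 : 0 < B := by positivity
    set ε := min ε₀ (r / 2 / B) with hε
    have hε0 : 0 < ε := by positivity
    have hεB : ε * B ≤ r / 2 := by
      have : ε ≤ r / 2 / B := min_le_right _ _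
      rwa [le_div_iff₀ hB0] at this
    have o1 : {v : WeakDual ℝ X | |v xb - u xb| < r / 2} ∈ 𝓝 (toWD u) := by
      refine IsOpen.mem_nhds (isOpen_lt ((WeakDual.eval_continuous xb).sub continuous_const).abs continuous_const) ?_
      change |u xb - u xb| < r / 2
      simpa using hr
    have o2 : {v : WeakDual ℝ X | -(v xt) < |u xt| + 1} ∈ 𝓝 (toWD u) := by
      refine IsOpen.mem_nhds (isOpen_lt (WeakDual.eval_continuous xt).neg continuous_const) ?_
      change -(u xt) < |u xt| + 1
      linarith [neg_abs_le (u xt)]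
    have hucl : toWD u ∈ closure (toWD '' coneHull (dg '' {t : T | -ε ≤ g t xb})) := hu ε hε0
    obtain ⟨_, ⟨⟨hv1, hv2⟩, hv3⟩, ⟨_, ⟨n, c, v, hc, hv, rfl⟩, rfl⟩⟩ :=
      mem_closure_iff_nhds.1 hucl _ (inter_mem (inter_mem hN₁ o1) o2)
    choose t ht hvt using hv
    change |(∑ i, c i • v i) xb - u xb| < r / 2 at hv2
    change -((∑ i, c i • v i) xt) < |u xt| + 1 at hv3
    simp only [_root_.sum_apply, _root_.smul_apply, smul_eq_mul, ← hvt] at hv2 hv3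
    have hsumc : (∑ i, c i) * δ ≤ |u xt| + 1 := by
      refine le_trans ?_ hv3.le
      rw [Finset.sum_mul, ← Finset.sum_neg_distrib]
      refine Finset.sum_le_sum fun i _ => ?_
      have a := ht i
      simp only [mem_ofPred_eq] at a
      have : ε ≤ ε₀ := min_le_left _ _
      have b := hxt (t i) (by linarith)
      nlinarith [hc i]
    have hsumB : ∑ i, c i ≤ B := by rwa [hB, le_div_iff₀ hδ]
    have hlow : 0 ≤ ∑ i, c i * (-(g (t i) xb)) :=
      Finset.sum_nonneg fun i _ => mul_nonneg (hc i) (by linarith [hxb (t i)])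
    have hup : ∑ i, c i * (-(g (t i) xb)) ≤ r / 2 := by
      have : ∑ i, c i * (-(g (t i) xb)) ≤ (∑ i, c i) * ε := by
        rw [Finset.sum_mul]
        refine Finset.sum_le_sum fun i _ => mul_le_mul_of_nonneg_left ?_ (hc i)
        have a := ht i
        simp only [mem_ofPred_eq] at a
        linarith
      nlinarith
    refine ⟨(toWD (∑ i, c i • v i), ∑ i, c i * (dg (t i) xb - g (t i) xb)), hsub ⟨hv1, hball ?_⟩,
      ⟨(∑ i, c i • v i, ∑ i, c i * (dg (t i) xb - g (t i) xb)),
        ⟨n, c, fun i => (dg (t i), dg (t i) xb - g (t i) xb), hc, fun i => ⟨t i, rfl⟩, ?_⟩, rfl⟩⟩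
    · rw [Metric.mem_ball, Real.dist_eq]
      have e : ∑ i, c i * (dg (t i) xb - g (t i) xb) = ∑ i, c i * dg (t i) xb + ∑ i, c i * (-(g (t i) xb)) := by
        rw [← Finset.sum_add_distrib]
        exact Finset.sum_congr rfl fun i _ => by ring
      rw [e]
      have := abs_lt.1 hv2
      exact abs_lt.2 ⟨by linarith, by linarith⟩
    · simp only [← hvt]
      ext1
      · simp [Prod.fst_sum]
      · simp [Prod.snd_sum]
  obtain ⟨⟨_, _⟩, ⟨n, c, v, hc, hv, heq⟩, he⟩ := hmem
  choose t ht using hv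
  rw [Prod.mk.injEq] at he
  obtain ⟨he1, he2⟩ := he
  rw [Prod.ext_iff] at heq
  obtain ⟨h1, h2⟩ := heq
  simp only [← ht, Prod.fst_sum, Prod.snd_sum, Prod.smul_fst, Prod.smul_snd, smul_eq_mul] at h1 h2
  change _ = u at he1
  simp only at he1 he2
  rw [h1] at he1
  rw [h2] at he2
  have hzero : ∑ i, c i * (-(g (t i) xb)) = 0 := by
    have e : ∑ i, c i * (dg (t i) xb - g (t i) xb) = ∑ i, c i * dg (t i) xb + ∑ i, c i * (-(g (t i) xb)) := by
      rw [← Finset.sum_add_distrib]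
      exact Finset.sum_congr rfl fun i _ => by ring
    rw [e] at he2
    have he3 : (∑ i, c i • dg (t i)) xb = u xb := DFunLike.congr_fun (F := X →L[ℝ] ℝ) he1 xb
    simp only [_root_.sum_apply, _root_.smul_apply, smul_eq_mul] at he3
    linarith
  have hz : ∀ i, c i * (-(g (t i) xb)) = 0 := fun i =>
    (Finset.sum_eq_zero_iff_of_nonneg (fun i _ => mul_nonneg (hc i) (by linarith [hxb (t i)]))).1 hzero i
      (Finset.mem_univ i)
  classical
  let L : T →₀ ℝ := ∑ i, Finsupp.single (t i) (c i)
  have hL : ∀ s, L s = ∑ i, if t i = s then c i else 0 := by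
    intro s
    simp [L, Finsupp.finsetSum_apply, Finsupp.single_apply]
  refine ⟨L, L.finite_support, fun s => ?_, fun s hs => ?_, ?_⟩
  · rw [hL]
    refine Finset.sum_nonneg fun i _ => ?_
    split_ifs
    · exact hc i
    · exact le_rfl
  · rw [hL]
    refine Finset.sum_eq_zero fun i _ => ?_
    split_ifs with h
    · have := hz i
      rw [h] at this
      rcases mul_eq_zero.1 this with h' | h'
      · exact h'
      · exact absurd (neg_eq_zero.1 h') hs
    · rfl
  · have e1 : ∑ᶠ s, L s • dg s = L.sum fun s a => a • dg s := by
      rw [Finsupp.sum]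
      refine finsum_eq_sum_of_support_subset _ fun s hs => ?_
      simp only [Finset.mem_coe, Finsupp.mem_support_iff]
      intro h0
      simp [h0] at hs
    rw [e1, ← he1]
    simp only [L]
    rw [← Finsupp.sum_finsetSum_index (fun a => by simp) (fun a b₁ b₂ => add_smul _ _ _)]
    exact Finset.sum_congr rfl fun i _ => by simp

end Aux

/-- convex infinite programs: for the convex program `min f` over
`Ω = {x | A x = 0, g t x ≤ 0 ∀ t}` with all `g t` convex and uniformly Fréchet differentiable
at `xb ∈ Ω`, `A` surjective continuous linear, `f` convex and continuous at some point of `Ω`,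
and the PMFCQ (equivalently SSC) holding at `xb`: `xb` is a global minimizer iff
`0 ∈ ∂f(xb) + ⋂_{ε>0} cl* cone{dg t : t ∈ T_ε(xb)} + A*(Y*)`; and if in addition the NFMCQ
holds at `xb`, then `xb` is a global minimizer iff there are multipliers `lam t ≥ 0`, finitely
many nonzero, vanishing off `T(xb)`, and `q ∈ Y*` with
`0 ∈ ∂f(xb) + Σ_t lam t • dg t + A* q`. -/
theorem statement19 {X Y T : Type*} [NormedAddCommGroup X] [NormedSpace ℝ X] [CompleteSpace X]
    [NormedAddCommGroup Y] [NormedSpace ℝ Y] [CompleteSpace Y]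
    (f : X → ℝ) (g : T → X → ℝ) (dg : T → X →L[ℝ] ℝ) (A : X →L[ℝ] Y) (xb : X)
    (hconv : ∀ t : T, ConvexOn ℝ univ (g t))
    (hgd : ∀ t : T, HasFDerivAt (g t) (dg t) xb)
    (hbd : ∃ M : ℝ, ∀ t : T, ‖dg t‖ ≤ M)
    (hunif : UnifFrechetDiffAt g dg xb)
    (hxb : xb ∈ {x : X | A x = 0 ∧ ∀ t : T, g t x ≤ 0})
    (hsurj : Function.Surjective A)
    (hfconv : ConvexOn ℝ univ f)
    (hfcont : ∃ x₀ ∈ {x : X | A x = 0 ∧ ∀ t : T, g t x ≤ 0}, ContinuousAt f x₀)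
    (hpmfcq : ∃ xt : X, A xt = 0 ∧ PMFCQat g dg xb xt) :
    ((∀ x ∈ {x : X | A x = 0 ∧ ∀ t : T, g t x ≤ 0}, f xb ≤ f x) ↔
        (0 : X →L[ℝ] ℝ) ∈ convexSubdiff f xb +
          (⋂ ε > (0:ℝ), wkClosure (coneHull (dg '' {t : T | -ε ≤ g t xb}))) + adjRange A) ∧
      (IsWeakStarClosedProd (coneHull (Set.range fun t : T => (dg t, dg t xb - g t xb))) →
        ((∀ x ∈ {x : X | A x = 0 ∧ ∀ t : T, g t x ≤ 0}, f xb ≤ f x) ↔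
          ∃ (lam : T → ℝ) (q : Y →L[ℝ] ℝ) (p : X →L[ℝ] ℝ),
            (Function.support lam).Finite ∧ (∀ t : T, 0 ≤ lam t) ∧
            (∀ t : T, g t xb ≠ 0 → lam t = 0) ∧ p ∈ convexSubdiff f xb ∧
            (0 : X →L[ℝ] ℝ) = p + (∑ᶠ t : T, lam t • dg t) + q.comp A)) := by
  obtain ⟨hAxb, hgxb⟩ := hxb
  obtain ⟨xt, hAxt, ε₀, hε₀, δ, hδ, hxt⟩ := hpmfcq
  obtain ⟨M', hM'⟩ := hbd
  have hM : ∀ t, ‖dg t‖ ≤ |M'| := fun t => (hM' t).trans (le_abs_self _)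
  have hΩ : Convex ℝ {x : X | A x = 0 ∧ ∀ t : T, g t x ≤ 0} := by
    rintro x ⟨hx1, hx2⟩ y ⟨hy1, hy2⟩ a b ha hb hab
    refine ⟨by simp [hx1, hy1], fun t => ?_⟩
    have h := (hconv t).2 (mem_univ x) (mem_univ y) ha hb hab
    simp only [smul_eq_mul] at h
    nlinarith [hx2 t, hy2 t]
  have fwd : (∀ x ∈ {x : X | A x = 0 ∧ ∀ t : T, g t x ≤ 0}, f xb ≤ f x) →
      ∃ p ∈ convexSubdiff f xb,
      ∃ u ∈ (⋂ ε > (0:ℝ), wkClosure (coneHull (dg '' {t : T | -ε ≤ g t xb}))),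
      ∃ q : Y →L[ℝ] ℝ, p + u + q.comp A = 0 := by
    intro hmin
    obtain ⟨x₀, -, hx₀⟩ := hfcont
    obtain ⟨p, hp, hpn⟩ := aux_sum hfconv ⟨x₀, hx₀⟩ hΩ ⟨hAxb, hgxb⟩ hmin
    obtain ⟨u, hu, q, hq⟩ := aux_normal hM (abs_nonneg _) hsurj hunif hAxb hgxb hAxt hε₀ hδ hxt
      (-p) (fun x h1 h2 => by
        have := hpn x ⟨h1, h2⟩
        change -(p (x - xb)) ≤ 0
        linarith)
    exact ⟨p, hp, u, hu, q, by rw [add_assoc, ← hq]; simp⟩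
  have bwd : ∀ (p u : X →L[ℝ] ℝ) (q : Y →L[ℝ] ℝ), p ∈ convexSubdiff f xb →
      (∀ x : X, (∀ t, g t x ≤ 0) → u (x - xb) ≤ 0) → p + u + q.comp A = 0 →
      ∀ x ∈ {x : X | A x = 0 ∧ ∀ t : T, g t x ≤ 0}, f xb ≤ f x := by
    rintro p u q hp hu h x ⟨hx1, hx2⟩
    have a := hp x
    have b := hu x hx2
    have c := DFunLike.congr_fun h (x - xb)
    change p (x - xb) + u (x - xb) + q (A (x - xb)) = 0 at c
    rw [map_sub A, hx1, hAxb, sub_zero, map_zero] at c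
    linarith
  refine ⟨⟨fun hmin => ?_, ?_⟩, fun hnf => ⟨fun hmin => ?_, ?_⟩⟩
  · obtain ⟨p, hp, u, hu, q, h⟩ := fwd hmin
    exact ⟨p + u, ⟨p, hp, u, hu, rfl⟩, q.comp A, ⟨q, rfl⟩, h⟩
  · rintro ⟨_, ⟨p, hp, u, hu, rfl⟩, _, ⟨q, rfl⟩, h⟩
    exact bwd p u q hp (fun x hx => aux_ineq hconv hunif hε₀ hδ hxt hu hx) h
  · obtain ⟨p, hp, u, hu, q, h⟩ := fwd hmin
    obtain ⟨lam, h1, h2, h3, h4⟩ := aux_nfm hgxb hε₀ hδ hxt hu hnf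
    exact ⟨lam, q, p, h1, h2, h3, hp, by rw [← h4, h]⟩
  · rintro ⟨lam, q, p, h1, h2, h3, hp, h⟩
    refine bwd p _ q hp (fun x hx => ?_) h.symm
    have e1 : ∑ᶠ s, lam s • dg s = ∑ s ∈ h1.toFinset, lam s • dg s := by
      refine finsum_eq_sum_of_support_subset _ fun s hs => ?_
      simp only [Set.Finite.coe_toFinset, Function.mem_support]
      intro h0
      simp [h0] at hs
    rw [e1]
    simp only [_root_.sum_apply, _root_.smul_apply, smul_eq_mul]
    refine Finset.sum_nonpos fun t _ => ?_
    by_cases ht : g t xb = 0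
    · have a := aux_grad hconv hunif t x
      have b := hx t
      exact mul_nonpos_of_nonneg_of_nonpos (h2 t) (by linarith)
    · rw [h3 t ht, zero_mul]
end
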